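/- Let n ∈ ℕ with n ≥ 3. Then the system of sets of lengths of B_n = ⟨a, b | ba = b^n⟩ is 𝓛(B_n) = { x + (n−2)·[0,q] : x, q ∈ ℕ₀ with x = q = 0 or x > q }. -/

import Mathlib

/-- An atom (irreducible element) of a monoid: a non-unit `u` such that
`u = b * c` implies that `b` or `c` is a unit. -/
def IsMonAtom {M : Type*} [Monoid M] (u : M) : Prop :=
  ¬ IsUnit u ∧ ∀ b c : M, u = b * c → IsUnit b ∨ IsUnit c

/-- A monoid is reduced if its only invertible element is `1`. -/
def MonReduced (M : Type*) [Monoid M] : Prop := ∀ u : M, IsUnit u → u = 1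

/-- A monoid is (left and right) unit-cancellative if `a = a * u` or `a = u * a`
implies that `u` is a unit. -/
def UnitCancellative (M : Type*) [Monoid M] : Prop :=
  (∀ a u : M, a * u = a → IsUnit u) ∧ (∀ a u : M, u * a = a → IsUnit u)

/-- A monoid is atomic if every non-unit is a finite product of atoms. -/
def MonAtomic (M : Type*) [Monoid M] : Prop :=
  ∀ a : M, ¬ IsUnit a → ∃ l : List M, (∀ u ∈ l, IsMonAtom u) ∧ l.prod = a

attribute [local instance] Classical.propDecidable

/-- The set of lengths `L(a)` of an element: the set of all `k ∈ ℕ` such that `a`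
is a product of `k` atoms, with the convention `L(1) = {0}`. -/
noncomputable def setOfLengths {M : Type*} [Monoid M] (x : M) : Set ℕ :=
  if x = 1 then {0}
  else {k | ∃ l : List M, l.length = k ∧ (∀ u ∈ l, IsMonAtom u) ∧ l.prod = x}

/-- The system of sets of lengths `𝓛(M) = {L(a) : a ∈ M}`. -/
def LSystem (M : Type*) [Monoid M] : Set (Set ℕ) :=
  Set.range (setOfLengths (M := M))

/-- `U_k(M)`, the union of all sets of lengths containing `k`. -/
def unionOfLengths (M : Type*) [Monoid M] (k : ℕ) : Set ℕ :=
  ⋃₀ {L | L ∈ LSystem M ∧ k ∈ L}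
/-- The defining relation `b * a = b ^ n` of the monoid `B_n`, on the free
monoid over two generators (`0` stands for `a`, `1` stands for `b`). -/
def BnRel (n : ℕ) : FreeMonoid (Fin 2) → FreeMonoid (Fin 2) → Prop := fun x y =>
  x = FreeMonoid.of 1 * FreeMonoid.of 0 ∧ y = FreeMonoid.of 1 ^ n

/-- The congruence on the free monoid generated by the relation `b * a = b ^ n`. -/
def BnCon (n : ℕ) : Con (FreeMonoid (Fin 2)) := conGen (BnRel n)

/-- The monoid `B_n = ⟨ a, b ∣ b * a = b ^ n ⟩`. -/
abbrev Bn (n : ℕ) := (BnCon n).Quotient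

/-- The generator `a` of `B_n`. -/
def bA (n : ℕ) : Bn n := (BnCon n).mk' (FreeMonoid.of 0)

/-- The generator `b` of `B_n`. -/
def bB (n : ℕ) : Bn n := (BnCon n).mk' (FreeMonoid.of 1)
/-- The quantity `q_{m,n}`. -/
def qOf (m n : ℕ) : ℕ :=
  if m = 0 then 0 else if (n - 1) ∣ m then m / (n - 1) - 1 else m / (n - 1)

/-- The arithmetical progression `x + d·[0,q] = {x + d*j : 0 ≤ j ≤ q}`. -/
def apSet (x d q : ℕ) : Set ℕ := {y | ∃ j : ℕ, j ≤ q ∧ y = x + d * j}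

/-- Normal forms `a ^ i * b ^ m` of the elements of `B_n`, with `c = n - 1`. -/
@[ext]
structure BnNF (c : ℕ) where
  /-- The exponent of `a`. -/
  i : ℕ
  /-- The exponent of `b`. -/
  m : ℕ

namespace BnNF

variable {c : ℕ}

instance : Mul (BnNF c) :=
  ⟨fun x y => if x.m = 0 then ⟨x.i + y.i, y.m⟩ else ⟨x.i, x.m + c * y.i + y.m⟩⟩

instance : One (BnNF c) := ⟨⟨0, 0⟩⟩

lemma mul_def (x y : BnNF c) :
    x * y = if x.m = 0 then ⟨x.i + y.i, y.m⟩ else ⟨x.i, x.m + c * y.i + y.m⟩ := rfl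

lemma one_def : (1 : BnNF c) = ⟨0, 0⟩ := rfl

instance : Monoid (BnNF c) where
  one_mul x := by simp [mul_def, one_def]
  mul_one x := by
    rcases x with ⟨i, m⟩
    by_cases h : m = 0 <;> simp [mul_def, one_def, h]
  mul_assoc x y z := by
    rcases x with ⟨i, m⟩
    rcases y with ⟨j, k⟩
    rcases z with ⟨p, q⟩
    by_cases h : m = 0 <;> by_cases h' : k = 0 <;> simp [mul_def, h, h'] <;> ring

lemma a_pow (i : ℕ) : (⟨1, 0⟩ : BnNF c) ^ i = ⟨i, 0⟩ := by
  induction i with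
  | zero => rfl
  | succ i ih => simp [pow_succ, ih, mul_def]

lemma b_pow (m : ℕ) : (⟨0, 1⟩ : BnNF c) ^ m = ⟨0, m⟩ := by
  induction m with
  | zero => rfl
  | succ m ih => by_cases h : m = 0 <;> simp [pow_succ, ih, mul_def, h]

lemma mul_eq_one {x y : BnNF c} (h : x * y = 1) : x = 1 := by
  rcases x with ⟨i, m⟩
  rcases y with ⟨j, k⟩
  by_cases hm : m = 0
  · simp [mul_def, one_def, hm] at h ⊢
    omega
  · simp [mul_def, one_def, hm] at h

lemma eq_one_or_eq_one_of_mul_eq_a {x y : BnNF c} (h : x * y = ⟨1, 0⟩) : x = 1 ∨ y = 1 := by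
  rcases x with ⟨i, m⟩
  rcases y with ⟨j, k⟩
  by_cases hm : m = 0
  · simp [mul_def, one_def, hm] at h ⊢
    omega
  · simp [mul_def, hm] at h

lemma eq_one_or_eq_one_of_mul_eq_b (hc : c ≠ 0) {x y : BnNF c} (h : x * y = ⟨0, 1⟩) :
    x = 1 ∨ y = 1 := by
  rcases x with ⟨i, m⟩
  rcases y with ⟨j, k⟩
  by_cases hm : m = 0
  · simp [mul_def, one_def, hm] at h ⊢
    omega
  · simp [mul_def, one_def, hm] at h ⊢
    obtain ⟨-, h⟩ := h
    have := (Nat.mul_eq_zero.1 (show c * j = 0 by omega)).resolve_left hc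
    omega

end BnNF

lemma bB_mul_bA (n : ℕ) : bB n * bA n = bB n ^ n := by
  have h : BnCon n (FreeMonoid.of 1 * FreeMonoid.of 0) (FreeMonoid.of 1 ^ n) :=
    ConGen.Rel.of _ _ ⟨rfl, rfl⟩
  exact (Con.eq (BnCon n)).2 h

lemma bB_pow_mul_bA {n : ℕ} (hn : 1 ≤ n) (m : ℕ) :
    bB n ^ (m + 1) * bA n = bB n ^ (m + 1 + (n - 1)) := by
  rw [pow_succ, mul_assoc, bB_mul_bA, ← pow_add]
  congr 1
  omega

/-- The normal form of an element of `B_n`. -/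
def bnToNF {n : ℕ} (hn : 1 ≤ n) : Bn n →* BnNF (n - 1) :=
  (BnCon n).lift (FreeMonoid.lift ![⟨1, 0⟩, ⟨0, 1⟩]) <| by
    refine Con.conGen_le.2 ?_
    rintro _ _ ⟨rfl, rfl⟩
    simp only [Con.ker_rel, map_mul, map_pow, FreeMonoid.lift_eval_of, Matrix.cons_val_zero,
      Matrix.cons_val_one, BnNF.b_pow]
    simp only [BnNF.mul_def, BnNF.ext_iff]
    simp
    omega

lemma bnToNF_bA {n : ℕ} (hn : 1 ≤ n) : bnToNF hn (bA n) = ⟨1, 0⟩ := rfl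

lemma bnToNF_bB {n : ℕ} (hn : 1 ≤ n) : bnToNF hn (bB n) = ⟨0, 1⟩ := rfl

lemma bnToNF_pow_mul_pow {n : ℕ} (hn : 1 ≤ n) (i m : ℕ) :
    bnToNF hn (bA n ^ i * bB n ^ m) = ⟨i, m⟩ := by
  simp [bnToNF_bA, bnToNF_bB, BnNF.a_pow, BnNF.b_pow, BnNF.mul_def]

lemma exists_eq_pow_mul_pow {n : ℕ} (hn : 1 ≤ n) (x : Bn n) :
    ∃ i m : ℕ, x = bA n ^ i * bB n ^ m := by
  obtain ⟨w, rfl⟩ := Con.mk'_surjective (c := BnCon n) x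
  induction w using FreeMonoid.inductionOn' with
  | one => exact ⟨0, 0, by simp⟩
  | of_mul s w ih =>
    obtain ⟨i, m, h⟩ := ih
    rw [map_mul, h]
    fin_cases s
    · exact ⟨i + 1, m, by rw [pow_succ', mul_assoc]; rfl⟩
    · have key : ∀ i, bB n * bA n ^ i = bB n ^ (1 + (n - 1) * i) := by
        intro i
        induction i with
        | zero => simp
        | succ i ih =>
          rw [pow_succ, ← mul_assoc, ih, add_comm 1, bB_pow_mul_bA hn]
          congr 1
          ring
      refine ⟨0, 1 + (n - 1) * i + m, ?_⟩
      rw [pow_add, ← key, pow_zero, one_mul, mul_assoc]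
      rfl

lemma bnToNF_injective {n : ℕ} (hn : 1 ≤ n) : Function.Injective (bnToNF hn) := by
  intro x y h
  obtain ⟨i, m, rfl⟩ := exists_eq_pow_mul_pow hn x
  obtain ⟨j, k, rfl⟩ := exists_eq_pow_mul_pow hn y
  rw [bnToNF_pow_mul_pow, bnToNF_pow_mul_pow, BnNF.ext_iff] at h
  obtain ⟨rfl, rfl⟩ := h
  rfl

lemma isUnit_bn_iff {n : ℕ} (hn : 1 ≤ n) (x : Bn n) : IsUnit x ↔ x = 1 := by
  refine ⟨fun h => ?_, fun h => h ▸ isUnit_one⟩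
  obtain ⟨y, hy⟩ := h.exists_right_inv
  refine bnToNF_injective hn ?_
  rw [map_one]
  exact BnNF.mul_eq_one (y := bnToNF hn y) (by rw [← map_mul, hy, map_one])

lemma isMonAtom_bn_iff {n : ℕ} (hn : 2 ≤ n) (u : Bn n) :
    IsMonAtom u ↔ u = bA n ∨ u = bB n := by
  have hn1 : 1 ≤ n := by omega
  have one_iff : ∀ x : Bn n, x = 1 ↔ bnToNF hn1 x = ⟨0, 0⟩ := fun x => by
    rw [← BnNF.one_def, ← map_one (bnToNF hn1), (bnToNF_injective hn1).eq_iff]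
  have bA_ne : bA n ≠ 1 := by simp [one_iff, bnToNF_bA]
  have bB_ne : bB n ≠ 1 := by simp [one_iff, bnToNF_bB]
  simp only [IsMonAtom, isUnit_bn_iff hn1]
  constructor
  · rintro ⟨h1, h⟩
    obtain ⟨i, m, rfl⟩ := exists_eq_pow_mul_pow hn1 u
    rcases i with _ | i
    · rcases m with _ | m
      · simp at h1
      · right
        have := (h (bB n) (bB n ^ m) (by rw [pow_zero, one_mul, pow_succ'])).resolve_left bB_ne
        rw [pow_succ', this, pow_zero, one_mul, mul_one]
    · left
      have := (h (bA n) (bA n ^ i * bB n ^ m) (by rw [pow_succ', mul_assoc])).resolve_left bA_ne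
      rw [pow_succ', mul_assoc, this, mul_one]
  · have one_of_map : ∀ x y : Bn n, bnToNF hn1 x = 1 ∨ bnToNF hn1 y = 1 → x = 1 ∨ y = 1 :=
      fun x y => by simp only [one_iff, BnNF.one_def, imp_self]
    rintro (rfl | rfl)
    · refine ⟨bA_ne, fun x y h => one_of_map x y (BnNF.eq_one_or_eq_one_of_mul_eq_a ?_)⟩
      rw [← map_mul, ← h, bnToNF_bA]
    · refine ⟨bB_ne, fun x y h =>
        one_of_map x y (BnNF.eq_one_or_eq_one_of_mul_eq_b (by omega) ?_)⟩
      rw [← map_mul, ← h, bnToNF_bB]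

/-- The length of a word in `a` and `b`, in terms of the normal form of its value. -/
lemma length_of_prod {d : ℕ} (l : List (BnNF (d + 1)))
    (hl : ∀ u ∈ l, u = ⟨1, 0⟩ ∨ u = ⟨0, 1⟩) :
    (l.prod.m = 0 ∧ l.length = l.prod.i) ∨
      ∃ j : ℕ, j * (d + 1) + 1 ≤ l.prod.m ∧ l.length + j * d = l.prod.i + l.prod.m := by
  induction l with
  | nil => simp [BnNF.one_def]
  | cons u l ih =>
    have ih := ih fun v hv => hl v (List.mem_cons_of_mem _ hv)
    rw [List.prod_cons, List.length_cons]
    rcases hl u List.mem_cons_self with rfl | rfl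
    · simp only [BnNF.mul_def, if_true]
      rcases ih with ⟨h, h'⟩ | ⟨j, h, h'⟩
      · exact Or.inl ⟨h, by omega⟩
      · exact Or.inr ⟨j, h, by omega⟩
    · right
      simp only [BnNF.mul_def, one_ne_zero, if_false]
      rcases ih with ⟨h, h'⟩ | ⟨j, h, h'⟩
      · exact ⟨l.prod.i, by linarith, by linarith⟩
      · exact ⟨j + l.prod.i, by linarith, by linarith⟩

lemma setOfLengths_one {M : Type*} [Monoid M] : setOfLengths (1 : M) = {0} := by
  simp [setOfLengths]

/-- The lengths of `a ^ i * b ^ m`, for `m` positive, are the numbers `i + m - j * (n - 2)`. -/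
lemma mem_setOfLengths_bn {d i m : ℕ} (hm : m ≠ 0) (k : ℕ) :
    k ∈ setOfLengths (bA (d + 2) ^ i * bB (d + 2) ^ m) ↔
      ∃ j : ℕ, j * (d + 1) + 1 ≤ m ∧ k + j * d = i + m := by
  have hn : 1 ≤ d + 2 := by omega
  have inj := bnToNF_injective hn
  have h1 : bA (d + 2) ^ i * bB (d + 2) ^ m ≠ 1 := fun h => by
    have := congrArg (bnToNF hn) h
    rw [bnToNF_pow_mul_pow, map_one, BnNF.one_def, BnNF.ext_iff] at this
    exact hm this.2
  simp only [setOfLengths, if_neg h1, Set.mem_ofPred_eq, isMonAtom_bn_iff (by omega : 2 ≤ d + 2)]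
  constructor
  · rintro ⟨l, rfl, hl, hp⟩
    have := length_of_prod (d := d) (l.map (bnToNF hn)) (by
      intro u hu
      obtain ⟨v, hv, rfl⟩ := List.mem_map.1 hu
      rcases hl v hv with rfl | rfl
      · exact Or.inl rfl
      · exact Or.inr rfl)
    rw [← map_list_prod, hp, bnToNF_pow_mul_pow, List.length_map] at this
    exact this.resolve_left fun h => hm h.1
  · rintro ⟨j, hj, hk⟩
    obtain ⟨r, rfl⟩ := Nat.exists_eq_add_of_le hj
    refine ⟨List.replicate i (bA _) ++ bB _ :: (List.replicate j (bA _) ++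
      List.replicate r (bB _)), ?_, ?_, ?_⟩
    · simp only [List.length_append, List.length_cons, List.length_replicate]
      linarith
    · intro u hu
      simp only [List.mem_append, List.mem_cons, List.mem_replicate] at hu
      tauto
    · refine inj ?_
      rw [bnToNF_pow_mul_pow]
      simp only [List.prod_append, List.prod_cons, List.prod_replicate, map_mul, map_pow,
        bnToNF_bA, bnToNF_bB, BnNF.a_pow, BnNF.b_pow]
      simp [BnNF.mul_def]
      ring

lemma setOfLengths_bA_pow {n : ℕ} (hn : 2 ≤ n) (i : ℕ) : setOfLengths (bA n ^ i) = {i} := by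
  obtain ⟨d, rfl⟩ := Nat.exists_eq_add_of_le' hn
  have hn1 : 1 ≤ d + 2 := by omega
  rcases eq_or_ne i 0 with rfl | hi
  · rw [pow_zero, setOfLengths_one]
  have h1 : bA (d + 2) ^ i ≠ 1 := fun h => by
    have := congrArg (bnToNF hn1) h
    rw [map_pow, bnToNF_bA, BnNF.a_pow, map_one, BnNF.one_def, BnNF.ext_iff] at this
    exact hi this.1
  ext k
  simp only [setOfLengths, if_neg h1, Set.mem_ofPred_eq, isMonAtom_bn_iff hn,
    Set.mem_singleton_iff]
  constructor
  · rintro ⟨l, rfl, hl, hp⟩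
    have := length_of_prod (d := d) (l.map (bnToNF hn1)) (by
      intro u hu
      obtain ⟨v, hv, rfl⟩ := List.mem_map.1 hu
      rcases hl v hv with rfl | rfl
      · exact Or.inl rfl
      · exact Or.inr rfl)
    rw [← map_list_prod, hp, map_pow, bnToNF_bA, BnNF.a_pow, List.length_map] at this
    rcases this with h | ⟨j, h, -⟩
    · exact h.2
    · simp at h
  · rintro rfl
    exact ⟨List.replicate k (bA _), by simp, fun u hu => Or.inl (List.eq_of_mem_replicate hu),
      by simp⟩

lemma setOfLengths_bn {d i m q r : ℕ} (hr : r ≤ d) (hm : m = q * (d + 1) + r + 1) :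
    setOfLengths (bA (d + 2) ^ i * bB (d + 2) ^ m) = apSet (i + q + r + 1) d q := by
  ext k
  rw [mem_setOfLengths_bn (by omega)]
  subst hm
  constructor
  · rintro ⟨j, hj, hk⟩
    have hjq : j ≤ q := by
      by_contra! h
      have : (q + 1) * (d + 1) ≤ j * (d + 1) := Nat.mul_le_mul_right _ h
      linarith
    obtain ⟨t, rfl⟩ := Nat.exists_eq_add_of_le hjq
    exact ⟨t, by omega, by linarith⟩
  · rintro ⟨t, ht, rfl⟩
    obtain ⟨j, rfl⟩ := Nat.exists_eq_add_of_le ht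
    exact ⟨j, by nlinarith, by ring⟩

/-- For `n ≥ 3`, the system of sets of lengths of `B_n` is
`𝓛(B_n) = { x + (n−2)·[0,q] : x, q ∈ ℕ₀ with x = q = 0 or x > q }`. -/
theorem statement4 (n : ℕ) (hn : 3 ≤ n) :
    LSystem (Bn n)
      = {L | ∃ x q : ℕ, ((x = 0 ∧ q = 0) ∨ q < x) ∧ L = apSet x (n - 2) q} := by
  obtain ⟨d, rfl⟩ := Nat.exists_eq_add_of_le' (show 2 ≤ n by omega)
  have apSet_zero : ∀ x d : ℕ, apSet x d 0 = {x} := fun x d => by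
    ext y
    simp [apSet]
  rw [Nat.add_sub_cancel]
  ext L
  constructor
  · rintro ⟨x, rfl⟩
    obtain ⟨i, m, rfl⟩ := exists_eq_pow_mul_pow (by omega) x
    rcases m with _ | m
    · refine ⟨i, 0, by omega, ?_⟩
      rw [pow_zero, mul_one, setOfLengths_bA_pow (by omega), apSet_zero]
    · refine ⟨i + m / (d + 1) + m % (d + 1) + 1, m / (d + 1), by omega, ?_⟩
      exact setOfLengths_bn (Nat.le_of_lt_succ (Nat.mod_lt _ d.succ_pos))
        (by rw [Nat.div_add_mod'])
  · rintro ⟨x, q, ⟨rfl, rfl⟩ | h, rfl⟩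
    · exact ⟨1, by rw [setOfLengths_one, apSet_zero]⟩
    · obtain ⟨i, rfl⟩ := Nat.exists_eq_add_of_lt h
      refine ⟨bA _ ^ i * bB _ ^ (q * (d + 1) + 0 + 1), ?_⟩
      rw [setOfLengths_bn d.zero_le rfl]
      congr 1
      omega
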